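/- Scaled sparseness estimate on the harmonic measure: Let r > 0, δ ∈ (0, 1), and let K be a closed subset of the real interval [−r, r] with one-dimensional Lebesgue measure |K| ≥ 2r(1 − δ) and with 0 ∉ K. Let D_r = {z ∈ ℂ : |z| < r} and let ω be a harmonic measure function of K with respect to D_r. Then ω(0) ≥ (2/π) · arcsin( (1 − δ²) / (1 + δ²) ). -/

import Mathlib

open Complex MeasureTheory Metric Filter Set

/-- The planar Laplacian of a function `u : ℂ → ℝ`:
`Δu = ∂²u/∂x² + ∂²u/∂y²` expressed via iterated real Fréchet derivatives. -/
noncomputable def planarLaplacian (u : ℂ → ℝ) (z : ℂ) : ℝ :=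
  fderiv ℝ (fun w => fderiv ℝ u w 1) z 1 +
  fderiv ℝ (fun w => fderiv ℝ u w Complex.I) z Complex.I

/-- `u` is harmonic on the open set `U`: twice continuously differentiable
(in the real sense) and satisfying Laplace's equation on `U`. -/
def HarmonicOnSet (u : ℂ → ℝ) (U : Set ℂ) : Prop :=
  ContDiffOn ℝ 2 u U ∧ ∀ z ∈ U, planarLaplacian u z = 0

/-- `ω` is a harmonic measure function of the closed set `K` with respect to
the bounded open set `Ω`: harmonic on `Ω \ K`, with values in `[0,1]` there,
boundary values `1` on `K ∩ Ω` and `0` on `∂Ω \ K`. -/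
def IsHarmonicMeasureFn (ω : ℂ → ℝ) (Ω K : Set ℂ) : Prop :=
  HarmonicOnSet ω (Ω \ K) ∧
  (∀ z ∈ Ω \ K, 0 ≤ ω z ∧ ω z ≤ 1) ∧
  (∀ ζ ∈ K ∩ Ω, Filter.Tendsto ω (nhdsWithin ζ (Ω \ K)) (nhds 1)) ∧
  (∀ ζ ∈ frontier Ω \ K, Filter.Tendsto ω (nhdsWithin ζ (Ω \ K)) (nhds 0))

/-- The real part of the principal square root. -/
noncomputable def sqrtRe (w : ℂ) : ℝ := √((‖w‖ + w.re) / 2)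

lemma sqrtRe_eq_re_cpow (w : ℂ) : sqrtRe w = (w ^ (2⁻¹ : ℂ)).re := (cpow_inv_two_re w).symm

lemma continuous_sqrtRe : Continuous sqrtRe := by unfold sqrtRe; fun_prop

lemma sqrtRe_nonneg (w : ℂ) : 0 ≤ sqrtRe w := Real.sqrt_nonneg _

lemma sqrtRe_conj (w : ℂ) : sqrtRe (starRingEnd ℂ w) = sqrtRe w := by simp [sqrtRe]

lemma sqrtRe_ofReal (x : ℝ) : sqrtRe x = √x := by
  rcases le_total 0 x with h | h
  · simp [sqrtRe, abs_of_nonneg h]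
  · simp [sqrtRe, abs_of_nonpos h, Real.sqrt_eq_zero_of_nonpos h]

lemma cpow_inv_two_sq (w : ℂ) : (w ^ (2⁻¹ : ℂ)) ^ 2 = w := by
  simp

lemma cpow_inv_two_re_pos {w : ℂ} (hw : w ∈ slitPlane) : 0 < (w ^ (2⁻¹ : ℂ)).re := by
  rw [cpow_inv_two_re]
  apply Real.sqrt_pos.2
  rcases mem_slitPlane_iff.1 hw with h | h
  · linarith [norm_nonneg w]
  · have := abs_re_lt_norm.2 h
    linarith [neg_abs_le w.re]

lemma re_inv_pos {w : ℂ} (hw : 0 < w.re) : 0 < (w⁻¹).re := by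
  rw [inv_re]
  exact div_pos hw (normSq_pos.2 (by rintro rfl; simp at hw))

lemma eq_of_sq_eq_of_re_pos {a b : ℂ} (h : a ^ 2 = b ^ 2) (ha : 0 < a.re) (hb : 0 < b.re) :
    a = b := by
  rcases sq_eq_sq_iff_eq_or_eq_neg.1 h with h | h
  · exact h
  · rw [h, neg_re] at ha; linarith

lemma harmonicAt_sqrtRe_comp {f : ℂ → ℂ} {z : ℂ} (hf : AnalyticAt ℂ f z) (hz : f z ∈ slitPlane) :
    InnerProductSpace.HarmonicAt (fun w => sqrtRe (f w)) z := by
  simp only [sqrtRe_eq_re_cpow]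
  exact (hf.cpow analyticAt_const hz).harmonicAt_re

/-- With `s = 2t/(1+t²)` and `S = 2z/(1+z²)`, this is `(s + S)/(s - S)`. -/
noncomputable def slitKernel (t : ℝ) (z : ℂ) : ℂ :=
  ((t + z) * (1 + t * z)) / ((t - z) * (1 - t * z))

lemma slitKernel_conj (t : ℝ) (z : ℂ) :
    slitKernel t (starRingEnd ℂ z) = starRingEnd ℂ (slitKernel t z) := by
  simp [slitKernel]

lemma slitKernel_neg (t : ℝ) (z : ℂ) : slitKernel (-t) z = (slitKernel t z)⁻¹ := by
  simp only [slitKernel, inv_div, ofReal_neg]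
  rw [← neg_div_neg_eq]
  congr 1 <;> ring

lemma slitKernel_zero_right {t : ℝ} (ht : t ≠ 0) : slitKernel t 0 = 1 := by
  simp [slitKernel, ht]

lemma one_sub_mul_ne_zero {t : ℝ} {z : ℂ} (h : |t| * ‖z‖ < 1) : (1 : ℂ) - t * z ≠ 0 := by
  intro h0
  have h1 : (1 : ℂ) = t * z := by linear_combination h0
  have := congrArg norm h1
  simp at this
  linarith

lemma sub_ne_zero_of_im_ne_zero {z : ℂ} (t : ℝ) (hz : z.im ≠ 0) : (t : ℂ) - z ≠ 0 := by
  intro h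
  have := congrArg im h
  simp at this
  exact hz this

lemma slitKernel_eq_div (t : ℝ) {z : ℂ} (hz : 1 + z ^ 2 ≠ 0) :
    slitKernel t z = ((2 * t / (1 + t ^ 2) : ℝ) + 2 * z / (1 + z ^ 2)) /
      ((2 * t / (1 + t ^ 2) : ℝ) - 2 * z / (1 + z ^ 2)) := by
  have ht : (1 + (t : ℂ) ^ 2) ≠ 0 := by
    have : (1 + t ^ 2 : ℝ) ≠ 0 := by positivity
    exact_mod_cast this
  have hc : (2 / ((1 + (t : ℂ) ^ 2) * (1 + z ^ 2))) ≠ 0 := by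
    simp [ht, hz]
  rw [slitKernel, ← mul_div_mul_left _ _ hc]
  congr 1 <;> (push_cast; field_simp; ring)

lemma one_add_sq_ne_zero {z : ℂ} (hz : ‖z‖ < 1) : 1 + z ^ 2 ≠ 0 := by
  intro h
  have h1 : z ^ 2 = -1 := by linear_combination h
  have := congrArg norm h1
  rw [norm_pow, norm_neg, norm_one] at this
  nlinarith [norm_nonneg z]

lemma slitKernel_im (t : ℝ) (z : ℂ) :
    (slitKernel t z).im = 2 * t * (1 + t ^ 2) * z.im * (1 - ‖z‖ ^ 2) /
      normSq ((t - z) * (1 - t * z)) := by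
  rw [slitKernel, div_im, ← sub_div, ← normSq_eq_norm_sq]
  congr 1
  simp [normSq_apply]
  ring

lemma slitKernel_mem_slitPlane {t : ℝ} {z : ℂ} (ht : t ≠ 0) (ht1 : |t| ≤ 1) (hz : ‖z‖ < 1)
    (him : z.im ≠ 0) : slitKernel t z ∈ slitPlane := by
  right
  rw [slitKernel_im]
  have h1 : (t : ℂ) - z ≠ 0 := sub_ne_zero_of_im_ne_zero t him
  have h2 : (1 : ℂ) - t * z ≠ 0 := one_sub_mul_ne_zero
    (by nlinarith [norm_nonneg z, abs_nonneg t])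
  have h3 : 1 - ‖z‖ ^ 2 ≠ 0 := by nlinarith [norm_nonneg z]
  have h4 : (1 + t ^ 2) ≠ 0 := by positivity
  have h5 : normSq ((t - z) * (1 - t * z)) ≠ 0 := by
    rw [Ne, normSq_eq_zero]; exact mul_ne_zero h1 h2
  positivity

lemma sqrtRe_slitKernel_of_norm_eq_one (t : ℝ) {z : ℂ} (hz : ‖z‖ = 1) :
    sqrtRe (slitKernel t z) = 0 := by
  have hzz : z * starRingEnd ℂ z = 1 := by rw [mul_conj, normSq_eq_norm_sq, hz]; norm_num
  have hz0 : z ≠ 0 := by rintro rfl; simp at hz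
  have e1 : (t + z) * (1 + t * z) = z * ((normSq (t + z) : ℝ) : ℂ) := by
    rw [← mul_conj]; simp only [map_add, conj_ofReal]
    linear_combination (-(t + z)) * hzz
  have e2 : (t - z) * (1 - t * z) = z * ((-normSq (t - z) : ℝ) : ℂ) := by
    rw [ofReal_neg, ← mul_conj]; simp only [map_sub, conj_ofReal]
    linear_combination (-(t - z)) * hzz
  rw [slitKernel, e1, e2, mul_div_mul_left _ _ hz0, ← ofReal_div, sqrtRe_ofReal]
  apply Real.sqrt_eq_zero_of_nonpos
  exact div_nonpos_of_nonneg_of_nonpos (normSq_nonneg _) (neg_nonpos.2 (normSq_nonneg _))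

lemma im_joukowski (z : ℂ) : (2 * z / (1 + z ^ 2)).im = 2 * z.im * (1 - ‖z‖ ^ 2) /
    normSq (1 + z ^ 2) := by
  rw [div_im, ← sub_div, ← normSq_eq_norm_sq]
  congr 1
  simp [normSq_apply, pow_two]
  ring

lemma sq_sub_sq_mem_slitPlane (s : ℝ) {S : ℂ} (hS : S.im ≠ 0) :
    (s : ℂ) ^ 2 - S ^ 2 ∈ slitPlane := by
  rw [mem_slitPlane_iff]
  by_contra! h
  obtain ⟨h1, h2⟩ := h
  simp [pow_two] at h1 h2
  have h3 : S.re = 0 := by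
    have : S.re * S.im = 0 := by linarith
    simpa [hS] using this
  rw [h3] at h1
  have : 0 < S.im * S.im := mul_self_pos.2 hS
  nlinarith [mul_self_nonneg s]

lemma sqrtRe_add_sqrtRe_inv {s : ℝ} {S : ℂ} (hs : 0 < s) (hS : S.im ≠ 0) :
    sqrtRe ((s + S) / (s - S)) + sqrtRe ((s + S) / (s - S))⁻¹ =
      2 * (s / ((s : ℂ) ^ 2 - S ^ 2) ^ (2⁻¹ : ℂ)).re := by
  have hm : (s : ℂ) - S ≠ 0 := sub_ne_zero_of_im_ne_zero s hS
  have hp : (s : ℂ) + S ≠ 0 := by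
    simpa using sub_ne_zero_of_im_ne_zero (z := -S) s (by simpa using hS)
  have hsl : ((s : ℂ) + S) / (s - S) ∈ slitPlane := by
    right
    rw [div_im, ← sub_div]
    have : normSq ((s : ℂ) - S) ≠ 0 := by rwa [Ne, normSq_eq_zero]
    apply div_ne_zero _ this
    simp
    intro h
    have : s * S.im = 0 := by linarith
    simp [hs.ne', hS] at this
  set k := ((s : ℂ) + S) / (s - S) with hk
  have hsq := sq_sub_sq_mem_slitPlane s hS
  have hBp := cpow_inv_two_re_pos hsq
  have hBs := cpow_inv_two_sq ((s : ℂ) ^ 2 - S ^ 2)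
  set B := ((s : ℂ) ^ 2 - S ^ 2) ^ (2⁻¹ : ℂ)
  have hpp := cpow_inv_two_re_pos hsl
  have hps := cpow_inv_two_sq k
  rw [sqrtRe_eq_re_cpow, sqrtRe_eq_re_cpow, inv_cpow _ _ (slitPlane_arg_ne_pi hsl)]
  set p := k ^ (2⁻¹ : ℂ)
  have hp0 : p ≠ 0 := by intro h; simp [h] at hpp
  have hB0 : B ≠ 0 := by intro h; simp [h] at hBp
  have hr : 0 < (2 * (s : ℂ) / B).re := by
    have := re_inv_pos hBp
    have e : 2 * (s : ℂ) / B = ((2 * s : ℝ) : ℂ) * B⁻¹ := by push_cast; ring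
    rw [e, re_ofReal_mul]; positivity
  have key : p + p⁻¹ = 2 * s / B := by
    refine eq_of_sq_eq_of_re_pos ?_ (by rw [add_re]; linarith [re_inv_pos hpp]) hr
    have : (p + p⁻¹) ^ 2 = p ^ 2 + 2 + (p ^ 2)⁻¹ := by field_simp; ring
    rw [this, div_pow, hBs, hps, hk]
    have h3 : (s : ℂ) ^ 2 - S ^ 2 ≠ 0 := slitPlane_ne_zero hsq
    have h4 : (s : ℂ) ^ 2 - S ^ 2 = (s - S) * (s + S) := by ring
    rw [h4]
    field_simp
    ring
  rw [← add_re, key]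
  have e : 2 * (s : ℂ) / B = ((2 : ℝ) : ℂ) * (s / B) := by push_cast; ring
  rw [e, re_ofReal_mul]

/-- The density of the uniform law in the variable `2 arctan t`. -/
noncomputable def arctanDensity (t : ℝ) : ℝ := 2 / (Real.pi * (1 + t ^ 2))

lemma arctanDensity_pos (t : ℝ) : 0 < arctanDensity t := by
  have := Real.pi_pos
  unfold arctanDensity; positivity

lemma continuous_arctanDensity : Continuous arctanDensity := by
  have := Real.pi_pos
  unfold arctanDensity
  exact continuous_const.div (by fun_prop) (fun t => by positivity)

lemma continuousOn_slitKernel_left {z : ℂ} (hz : ‖z‖ < 1) (him : z.im ≠ 0) :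
    ContinuousOn (fun t : ℝ => slitKernel t z) (Icc (-1) 1) := by
  unfold slitKernel
  refine ContinuousOn.div (by fun_prop) (by fun_prop) fun t ht => ?_
  refine mul_ne_zero (sub_ne_zero_of_im_ne_zero t him) (one_sub_mul_ne_zero ?_)
  have := abs_le.2 ht
  nlinarith [norm_nonneg z, abs_nonneg t]

lemma hasDerivAt_log_add_cpow {S : ℂ} (hS : S.im ≠ 0) (t : ℝ) :
    HasDerivAt (fun t : ℝ => log (I * ((1 - t ^ 2) / (1 + t ^ 2) : ℝ) +
      (((2 * t / (1 + t ^ 2) : ℝ) : ℂ) ^ 2 - S ^ 2) ^ (2⁻¹ : ℂ)))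
      (-I * (2 / (1 + t ^ 2) : ℝ) * ((2 * t / (1 + t ^ 2) : ℝ) /
        (((2 * t / (1 + t ^ 2) : ℝ) : ℂ) ^ 2 - S ^ 2) ^ (2⁻¹ : ℂ))) t := by
  have ht : (1 + t ^ 2) ≠ 0 := by positivity
  have hc : HasDerivAt (fun t : ℝ => (1 - t ^ 2) / (1 + t ^ 2))
      (-(2 * t / (1 + t ^ 2)) * (2 / (1 + t ^ 2))) t := by
    have := (((hasDerivAt_id t).pow 2).const_sub 1).div (((hasDerivAt_id t).pow 2).const_add 1) ht
    refine (this.congr_deriv ?_)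
    simp; field_simp; ring
  have hs : HasDerivAt (fun t : ℝ => 2 * t / (1 + t ^ 2))
      ((1 - t ^ 2) / (1 + t ^ 2) * (2 / (1 + t ^ 2))) t := by
    have := ((hasDerivAt_id t).const_mul 2).div (((hasDerivAt_id t).pow 2).const_add 1) ht
    refine (this.congr_deriv ?_)
    simp; field_simp; ring
  have hsq := sq_sub_sq_mem_slitPlane (2 * t / (1 + t ^ 2)) hS
  have hin : HasDerivAt (fun t : ℝ => ((2 * t / (1 + t ^ 2) : ℝ) : ℂ) ^ 2 - S ^ 2) _ t :=
    (hs.ofReal_comp.pow 2).sub_const (S ^ 2)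
  have hcp : HasDerivAt (fun w : ℂ => w ^ (2⁻¹ : ℂ))
      (2⁻¹ * (((2 * t / (1 + t ^ 2) : ℝ) : ℂ) ^ 2 - S ^ 2) ^ ((2⁻¹ : ℂ) - 1))
      (((2 * t / (1 + t ^ 2) : ℝ) : ℂ) ^ 2 - S ^ 2) := by
    have := (hasDerivAt_id (((2 * t / (1 + t ^ 2) : ℝ) : ℂ) ^ 2 - S ^ 2)).cpow_const
      (c := (2⁻¹ : ℂ)) hsq
    rwa [mul_one] at this
  have hB : HasDerivAt
      (fun t : ℝ => (((2 * t / (1 + t ^ 2) : ℝ) : ℂ) ^ 2 - S ^ 2) ^ (2⁻¹ : ℂ)) _ t :=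
    HasDerivAt.comp (h₂ := fun w : ℂ => w ^ (2⁻¹ : ℂ)) t hcp hin
  have hG := (hc.ofReal_comp.const_mul I).fun_add hB
  have hBp := cpow_inv_two_re_pos hsq
  have hB2 := cpow_inv_two_sq (((2 * t / (1 + t ^ 2) : ℝ) : ℂ) ^ 2 - S ^ 2)
  have hsub : (((2 * t / (1 + t ^ 2) : ℝ) : ℂ) ^ 2 - S ^ 2) ^ ((2⁻¹ : ℂ) - 1) =
      ((((2 * t / (1 + t ^ 2) : ℝ) : ℂ) ^ 2 - S ^ 2) ^ (2⁻¹ : ℂ))⁻¹ := by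
    rw [← cpow_neg]; congr 1; norm_num
  rw [hsub] at hG
  have hsl : I * ((1 - t ^ 2) / (1 + t ^ 2) : ℝ) +
      (((2 * t / (1 + t ^ 2) : ℝ) : ℂ) ^ 2 - S ^ 2) ^ (2⁻¹ : ℂ) ∈ slitPlane := by
    left
    rw [add_re, mul_re, I_re, I_im, ofReal_im]
    simpa using hBp
  refine (hG.clog_real hsl).congr_deriv ?_
  have hX0 := slitPlane_ne_zero hsl
  generalize (((2 * t / (1 + t ^ 2) : ℝ) : ℂ) ^ 2 - S ^ 2) ^ (2⁻¹ : ℂ) = B at *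
  generalize (1 - t ^ 2) / (1 + t ^ 2) = c at *
  generalize 2 * t / (1 + t ^ 2) = s at *
  generalize 2 / (1 + t ^ 2) = m at *
  have hB0 : B ≠ 0 := by rintro rfl; simp at hBp
  push_cast
  rw [div_eq_iff hX0]
  field_simp
  linear_combination ((s : ℂ) * m * c) * I_sq

lemma integral_re_div_cpow_le {S : ℂ} (hS : S.im ≠ 0) (hS2 : 0 ≤ (1 - S ^ 2).im) :
    ∫ t in (0 : ℝ)..1, 2 / (1 + t ^ 2) * ((2 * t / (1 + t ^ 2) : ℝ) /
        (((2 * t / (1 + t ^ 2) : ℝ) : ℂ) ^ 2 - S ^ 2) ^ (2⁻¹ : ℂ)).re ≤ Real.pi / 2 := by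
  have hne : ∀ t : ℝ, 1 + t ^ 2 ≠ 0 := fun t => by positivity
  have hd : ∀ t : ℝ, HasDerivAt (fun t : ℝ => -(log (I * ((1 - t ^ 2) / (1 + t ^ 2) : ℝ) +
      (((2 * t / (1 + t ^ 2) : ℝ) : ℂ) ^ 2 - S ^ 2) ^ (2⁻¹ : ℂ))).im) (2 / (1 + t ^ 2) *
      ((2 * t / (1 + t ^ 2) : ℝ) /
        (((2 * t / (1 + t ^ 2) : ℝ) : ℂ) ^ 2 - S ^ 2) ^ (2⁻¹ : ℂ)).re) t := by
    intro t
    have := (imCLM.hasFDerivAt.comp_hasDerivAt t (hasDerivAt_log_add_cpow hS t)).neg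
    refine this.congr_deriv ?_
    rw [neg_mul, neg_mul, map_neg, neg_neg, imCLM_apply, mul_assoc, I_mul_im, re_ofReal_mul]
  rw [intervalIntegral.integral_eq_sub_of_hasDerivAt (fun t _ => hd t)]
  · have h1 := (abs_le.1 ((abs_arg_le_pi_div_two_iff (z := I * ((1 : ℝ) : ℂ) +
      (((0 : ℝ) : ℂ) ^ 2 - S ^ 2) ^ (2⁻¹ : ℂ))).2 (by
        rw [add_re]; simpa using (cpow_inv_two_re_pos (sq_sub_sq_mem_slitPlane 0 hS)).le))).2
    have h2 : 0 ≤ ((1 - S ^ 2) ^ (2⁻¹ : ℂ)).arg := by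
      rw [arg_nonneg_iff, cpow_inv_two_im_eq_sqrt hS2]
      exact Real.sqrt_nonneg _
    have e1 : (2 * 1 / (1 + 1 ^ 2) : ℝ) = 1 := by norm_num
    have e2 : ((1 - 1 ^ 2) / (1 + 1 ^ 2) : ℝ) = 0 := by norm_num
    have e3 : (2 * 0 / (1 + 0 ^ 2) : ℝ) = 0 := by norm_num
    have e4 : ((1 - 0 ^ 2) / (1 + 0 ^ 2) : ℝ) = 1 := by norm_num
    simp only [log_im, e1, e2, e3, e4]
    rw [ofReal_zero, mul_zero, zero_add, ofReal_one, one_pow]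
    rw [ofReal_one, ofReal_zero] at h1
    linarith
  · apply Continuous.intervalIntegrable
    have hs : Continuous fun t : ℝ => 2 * t / (1 + t ^ 2) := by
      exact Continuous.div (by fun_prop) (by fun_prop) hne
    refine (continuous_const.div (by fun_prop) hne).mul (continuous_re.comp ?_)
    refine (continuous_ofReal.comp hs).div ?_ ?_
    · exact Continuous.cpow (by fun_prop) continuous_const (fun t => sq_sub_sq_mem_slitPlane _ hS)
    · intro t h
      have := cpow_inv_two_re_pos (sq_sub_sq_mem_slitPlane (2 * t / (1 + t ^ 2)) hS)
      rw [h] at this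
      simp at this

lemma integral_slitKernel_le_aux {z : ℂ} (hz : ‖z‖ < 1) (him : z.im ≠ 0)
    (h2 : 0 ≤ (1 - (2 * z / (1 + z ^ 2)) ^ 2).im) :
    ∫ t in (-1 : ℝ)..1, sqrtRe (slitKernel t z) * arctanDensity t ≤ 1 := by
  have hS : (2 * z / (1 + z ^ 2)).im ≠ 0 := by
    rw [im_joukowski]
    have h3 : 1 - ‖z‖ ^ 2 ≠ 0 := by nlinarith [norm_nonneg z]
    have h5 : normSq (1 + z ^ 2) ≠ 0 := by
      rw [Ne, normSq_eq_zero]; exact one_add_sq_ne_zero hz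
    positivity
  have hcont : ContinuousOn (fun t => sqrtRe (slitKernel t z) * arctanDensity t) (Icc (-1) 1) :=
    (continuous_sqrtRe.comp_continuousOn (continuousOn_slitKernel_left hz him)).mul
      continuous_arctanDensity.continuousOn
  have hi : ∀ a b : ℝ, -1 ≤ a → a ≤ b → b ≤ 1 → IntervalIntegrable
      (fun t => sqrtRe (slitKernel t z) * arctanDensity t) volume a b := fun a b ha hab hb =>
    (hcont.mono (Icc_subset_Icc ha hb)).intervalIntegrable_of_Icc hab
  rw [← intervalIntegral.integral_add_adjacent_intervals
    (hi (-1) 0 le_rfl (by norm_num) (by norm_num))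
    (hi 0 1 (by norm_num) (by norm_num) le_rfl)]
  have hneg : ∫ t in (-1 : ℝ)..0, sqrtRe (slitKernel t z) * arctanDensity t =
      ∫ t in (0 : ℝ)..1, sqrtRe (slitKernel t z)⁻¹ * arctanDensity t := by
    have := intervalIntegral.integral_comp_neg (a := 0) (b := 1)
      (fun t => sqrtRe (slitKernel t z) * arctanDensity t)
    simp only [neg_zero] at this
    rw [← this]
    simp only [slitKernel_neg, arctanDensity, neg_sq]
  have hi' : IntervalIntegrable (fun t => sqrtRe (slitKernel t z)⁻¹ * arctanDensity t)
      volume 0 1 := by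
    have := (hi (-1) 0 le_rfl (by norm_num) (by norm_num)).comp_sub_left 0
    simp only [zero_sub, slitKernel_neg, arctanDensity, neg_sq, neg_neg, sub_zero] at this
    exact this.symm
  rw [hneg, ← intervalIntegral.integral_add hi' (hi 0 1 (by norm_num) (by norm_num) le_rfl)]
  have hpt : ∫ t in (0 : ℝ)..1, (sqrtRe (slitKernel t z)⁻¹ * arctanDensity t +
      sqrtRe (slitKernel t z) * arctanDensity t) = ∫ t in (0 : ℝ)..1, 2 / Real.pi *
        (2 / (1 + t ^ 2) * ((2 * t / (1 + t ^ 2) : ℝ) / (((2 * t / (1 + t ^ 2) : ℝ) : ℂ) ^ 2 -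
          (2 * z / (1 + z ^ 2)) ^ 2) ^ (2⁻¹ : ℂ)).re) := by
    apply intervalIntegral.integral_congr_ae
    refine Eventually.of_forall fun t ht => ?_
    rw [uIoc_of_le (by norm_num)] at ht
    have hs : 0 < 2 * t / (1 + t ^ 2) := by have := ht.1; positivity
    have := sqrtRe_add_sqrtRe_inv hs hS
    rw [← slitKernel_eq_div t (one_add_sq_ne_zero hz)] at this
    rw [← add_mul, add_comm, this, arctanDensity]
    have hp := Real.pi_ne_zero
    have : 1 + t ^ 2 ≠ 0 := by positivity
    field_simp
  rw [hpt, intervalIntegral.integral_const_mul]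
  calc _ ≤ 2 / Real.pi * (Real.pi / 2) :=
        mul_le_mul_of_nonneg_left (integral_re_div_cpow_le hS h2)
          (by have := Real.pi_pos; positivity)
    _ = 1 := by have := Real.pi_ne_zero; field_simp

lemma integral_slitKernel_le {z : ℂ} (hz : ‖z‖ < 1) (him : z.im ≠ 0) :
    ∫ t in (-1 : ℝ)..1, sqrtRe (slitKernel t z) * arctanDensity t ≤ 1 := by
  rcases le_total 0 (1 - (2 * z / (1 + z ^ 2)) ^ 2).im with h | h
  · exact integral_slitKernel_le_aux hz him h
  · have := integral_slitKernel_le_aux (z := starRingEnd ℂ z) (by simpa using hz)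
      (by simpa using him) (by
        have e : 1 - (2 * starRingEnd ℂ z / (1 + starRingEnd ℂ z ^ 2)) ^ 2 =
            starRingEnd ℂ (1 - (2 * z / (1 + z ^ 2)) ^ 2) := by
          simp only [map_sub, map_one, map_pow, map_div₀, map_mul, map_add, map_ofNat]
        rw [e, conj_im]; linarith)
    simpa only [slitKernel_conj, sqrtRe_conj] using this

lemma continuousAt_setIntegral_of_continuousOn {f : ℝ → ℂ → ℝ} {L : Set ℝ} (hL : IsCompact L)
    {V : Set ℂ} (hV : IsOpen V) (hf : ContinuousOn (fun p : ℝ × ℂ => f p.1 p.2) (L ×ˢ V))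
    {z₀ : ℂ} (hz₀ : z₀ ∈ V) : ContinuousAt (fun z => ∫ t in L, f t z) z₀ := by
  obtain ⟨ε, hε, hball⟩ := Metric.nhds_basis_closedBall.mem_iff.1 (hV.mem_nhds hz₀)
  obtain ⟨C, hC⟩ := (hL.prod (isCompact_closedBall z₀ ε)).exists_bound_of_continuousOn
    (hf.mono (prod_mono_right hball))
  have hleft : ∀ z ∈ V, ContinuousOn (fun t => f t z) L := fun z hz =>
    hf.comp (f := fun t : ℝ => (t, z)) (by fun_prop) (fun t ht => ⟨ht, hz⟩)
  refine continuousAt_of_dominated (bound := fun _ => C) ?_ ?_ ?_ ?_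
  · filter_upwards [hV.mem_nhds hz₀] with z hz
    exact (hleft z hz).aestronglyMeasurable hL.measurableSet
  · filter_upwards [closedBall_mem_nhds z₀ hε] with z hz
    filter_upwards [ae_restrict_mem hL.measurableSet] with t ht
    exact hC (t, z) ⟨ht, hz⟩
  · exact integrableOn_const hL.measure_lt_top.ne
  · filter_upwards [ae_restrict_mem hL.measurableSet] with t ht
    have : ContinuousOn (fun z => f t z) V :=
      hf.comp (f := fun z : ℂ => (t, z)) (by fun_prop) (fun z hz => ⟨ht, hz⟩)
    exact this.continuousAt (hV.mem_nhds hz₀)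

/-- For compact `L ⊆ (-1, 1)`, the `L`-part of an explicit integral over `[-1, 1]` of harmonic
functions which is bounded by `1` off the real axis. -/
noncomputable def comparisonFn (L : Set ℝ) (z : ℂ) : ℝ :=
  ∫ t in L, sqrtRe (slitKernel t z) * arctanDensity t

/-- The set on which all the kernels `slitKernel t`, `t ∈ L`, are regular. -/
def regularSet (L : Set ℝ) : Set ℂ := {z | ∀ t ∈ L, (t - z) * (1 - t * z) ≠ 0}

lemma isOpen_regularSet {L : Set ℝ} (hL : IsCompact L) : IsOpen (regularSet L) := by
  rw [isOpen_iff_mem_nhds]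
  intro z hz
  refine hL.eventually_forall_of_forall_eventually fun t ht => ?_
  have hc : Continuous fun p : ℂ × ℝ => ((p.2 : ℂ) - p.1) * (1 - p.2 * p.1) := by fun_prop
  exact hc.continuousAt.eventually_ne (hz t ht)

lemma mem_regularSet {L : Set ℝ} {ρ : ℝ} (hρ : ρ < 1) (hL : L ⊆ Icc (-ρ) ρ) {z : ℂ}
    (hz : ‖z‖ ≤ 1) (hzL : z ∉ ofReal '' L) : z ∈ regularSet L := by
  intro t ht
  refine mul_ne_zero ?_ (one_sub_mul_ne_zero ?_)
  · intro h
    exact hzL ⟨t, ht, by linear_combination h⟩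
  · have := abs_le.2 (hL ht)
    nlinarith [norm_nonneg z, abs_nonneg t]

lemma continuousOn_kernel (L : Set ℝ) : ContinuousOn
    (fun p : ℝ × ℂ => sqrtRe (slitKernel p.1 p.2) * arctanDensity p.1) (L ×ˢ regularSet L) := by
  refine ContinuousOn.mul (continuous_sqrtRe.comp_continuousOn ?_)
    (continuous_arctanDensity.comp continuous_fst).continuousOn
  unfold slitKernel
  exact ContinuousOn.div (by fun_prop) (by fun_prop) fun p hp => hp.2 _ hp.1

lemma integrableOn_kernel {L : Set ℝ} (hL : IsCompact L) {z : ℂ} (hz : z ∈ regularSet L) :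
    IntegrableOn (fun t => sqrtRe (slitKernel t z) * arctanDensity t) L :=
  ((continuousOn_kernel L).comp (f := fun t : ℝ => (t, z)) (by fun_prop)
    (fun t ht => ⟨ht, hz⟩)).integrableOn_compact hL

lemma continuousAt_comparisonFn {L : Set ℝ} (hL : IsCompact L) {z : ℂ} (hz : z ∈ regularSet L) :
    ContinuousAt (comparisonFn L) z :=
  continuousAt_setIntegral_of_continuousOn hL (isOpen_regularSet hL) (continuousOn_kernel L) hz

lemma comparisonFn_zero {L : Set ℝ} (hL : MeasurableSet L) (h0 : (0 : ℝ) ∉ L) :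
    comparisonFn L 0 = ∫ t in L, arctanDensity t := by
  refine setIntegral_congr_fun hL fun t ht => ?_
  have : t ≠ 0 := by rintro rfl; exact h0 ht
  simp [slitKernel_zero_right this, sqrtRe]

lemma comparisonFn_of_norm_eq_one (L : Set ℝ) {z : ℂ} (hz : ‖z‖ = 1) : comparisonFn L z = 0 := by
  simp [comparisonFn, sqrtRe_slitKernel_of_norm_eq_one _ hz]

lemma comparisonFn_le_one_of_im_ne_zero {L : Set ℝ} (hL : L ⊆ Icc (-1) 1)
    {z : ℂ} (hz : ‖z‖ < 1) (him : z.im ≠ 0) : comparisonFn L z ≤ 1 := by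
  refine le_trans ?_ (integral_slitKernel_le hz him)
  rw [intervalIntegral.integral_of_le (by norm_num), ← integral_Icc_eq_integral_Ioc]
  refine setIntegral_mono_set ?_ ?_ hL.eventuallyLE
  · exact ((continuous_sqrtRe.comp_continuousOn (continuousOn_slitKernel_left hz him)).mul
      continuous_arctanDensity.continuousOn).integrableOn_compact isCompact_Icc
  · exact Eventually.of_forall fun t => mul_nonneg (sqrtRe_nonneg _) (arctanDensity_pos t).le

lemma comparisonFn_le_one {L : Set ℝ} (hL : IsCompact L) (hL1 : L ⊆ Icc (-1) 1) {z : ℂ}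
    (hz : ‖z‖ < 1) (hzL : z ∈ regularSet L) : comparisonFn L z ≤ 1 := by
  have ht : Tendsto (fun τ : ℝ => z + τ * I) (nhdsWithin 0 {τ | z.im + τ ≠ 0}) (nhds z) := by
    have : Continuous fun τ : ℝ => z + τ * I := by fun_prop
    simpa using (this.tendsto 0).mono_left nhdsWithin_le_nhds
  have hne : (nhdsWithin (0 : ℝ) {τ | z.im + τ ≠ 0}).NeBot := by
    have : {τ : ℝ | z.im + τ ≠ 0} = {-z.im}ᶜ := by
      ext τ; simp [eq_neg_iff_add_eq_zero, add_comm]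
    rw [this]
    exact mem_closure_iff_nhdsWithin_neBot.1 ((dense_compl_singleton (-z.im)) 0)
  refine le_of_tendsto ((continuousAt_comparisonFn hL hzL).tendsto.comp ht) ?_
  filter_upwards [self_mem_nhdsWithin, ht (isOpen_ball.mem_nhds (mem_ball_zero_iff.2 hz))]
    with τ h1 h2
  exact comparisonFn_le_one_of_im_ne_zero hL1 (mem_ball_zero_iff.1 h2) (by simpa using h1)

lemma circleAverage_comparisonFn {L : Set ℝ} (hL : IsCompact L) (hL1 : L ⊆ Icc (-1) 1)
    (h0 : (0 : ℝ) ∉ L) {z : ℂ} {R : ℝ} (hR : 0 ≤ R)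
    (hball : closedBall z R ⊆ regularSet L ∩ {w | ‖w‖ < 1 ∧ w.im ≠ 0}) :
    Real.circleAverage (comparisonFn L) z R = comparisonFn L z := by
  have hmem : ∀ θ, circleMap z R θ ∈ regularSet L := fun θ =>
    (hball (circleMap_mem_closedBall z hR θ)).1
  have hint : IntegrableOn (fun p : ℝ × ℝ =>
      sqrtRe (slitKernel p.2 (circleMap z R p.1)) * arctanDensity p.2)
      (Icc 0 (2 * Real.pi) ×ˢ L) := by
    refine ContinuousOn.integrableOn_compact (isCompact_Icc.prod hL) ?_
    exact (continuousOn_kernel L).comp (f := fun p : ℝ × ℝ => (p.2, circleMap z R p.1))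
      (by have := continuous_circleMap z R; fun_prop) (fun p hp => ⟨hp.2, hmem _⟩)
  have hpi : (0 : ℝ) ≤ 2 * Real.pi := by have := Real.pi_pos; positivity
  rw [IntegrableOn, Measure.volume_eq_prod, ← Measure.prod_restrict] at hint
  rw [Real.circleAverage_def, intervalIntegral.integral_of_le hpi, ← integral_Icc_eq_integral_Ioc]
  unfold comparisonFn
  rw [integral_integral_swap hint, ← integral_smul]
  refine setIntegral_congr_fun hL.measurableSet fun t ht => ?_
  rw [integral_mul_const, integral_Icc_eq_integral_Ioc, ← intervalIntegral.integral_of_le hpi,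
    ← smul_mul_assoc, ← Real.circleAverage_def (f := fun w => sqrtRe (slitKernel t w))]
  congr 1
  apply InnerProductSpace.HarmonicOnNhd.circleAverage_eq
  rw [abs_of_nonneg hR]
  intro w hw
  obtain ⟨hw1, hw2, hw3⟩ := hball hw
  refine harmonicAt_sqrtRe_comp ?_ (slitKernel_mem_slitPlane (by rintro rfl; exact h0 ht)
    (abs_le.2 (hL1 ht)) hw2 hw3)
  unfold slitKernel
  exact AnalyticAt.div (by fun_prop) (by fun_prop) (hw1 t ht)

lemma sqrtRe_div_mul_le {s σ : ℝ} (τ : ℝ) (h : s ≠ σ) :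
    sqrtRe ((s + σ) / (s - σ)) * (1 - τ ^ 2 / (s - σ) ^ 2) ≤
      sqrtRe ((s + (σ + τ * I)) / (s - (σ + τ * I))) := by
  have e : ((s + σ) / (s - σ) : ℂ) = ((s + σ) / (s - σ) : ℝ) := by push_cast; rfl
  have hs : s - σ ≠ 0 := sub_ne_zero.2 h
  rw [e, sqrtRe_ofReal]
  rcases le_total ((s + σ) / (s - σ)) 0 with h0 | h0
  · rw [Real.sqrt_eq_zero_of_nonpos h0, zero_mul]
    exact sqrtRe_nonneg _
  rcases le_total (1 - τ ^ 2 / (s - σ) ^ 2) 0 with h1 | h1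
  · exact (mul_nonpos_of_nonneg_of_nonpos (Real.sqrt_nonneg _) h1).trans (sqrtRe_nonneg _)
  have hA : 0 ≤ s ^ 2 - σ ^ 2 := by
    have : s ^ 2 - σ ^ 2 = (s + σ) / (s - σ) * (s - σ) ^ 2 := by field_simp; ring
    rw [this]; positivity
  have hd : 0 < (s - σ) ^ 2 := by positivity
  have hD : 0 < (s - σ) ^ 2 + τ ^ 2 := by positivity
  have hN : normSq ((s : ℂ) - (σ + τ * I)) = (s - σ) ^ 2 + τ ^ 2 := by
    simp [normSq_apply]; ring
  have hre : ((s + (σ + τ * I)) / (s - (σ + τ * I)) : ℂ).re =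
      (s ^ 2 - σ ^ 2 - τ ^ 2) / ((s - σ) ^ 2 + τ ^ 2) := by
    rw [div_re, ← add_div, hN]
    congr 1
    simp; ring
  have hnorm : (s ^ 2 - σ ^ 2 + τ ^ 2) / ((s - σ) ^ 2 + τ ^ 2) ≤
      ‖((s + (σ + τ * I)) / (s - (σ + τ * I)) : ℂ)‖ := by
    refine le_of_sq_le_sq ?_ (norm_nonneg _)
    rw [← normSq_eq_norm_sq, normSq_div, hN, div_pow, div_le_div_iff₀ (by positivity) hD]
    have : normSq ((s : ℂ) + (σ + τ * I)) = (s + σ) ^ 2 + τ ^ 2 := by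
      simp [normSq_apply]; ring
    rw [this]
    have : (s ^ 2 - σ ^ 2 + τ ^ 2) ^ 2 ≤ ((s + σ) ^ 2 + τ ^ 2) * ((s - σ) ^ 2 + τ ^ 2) := by
      nlinarith [mul_nonneg (sq_nonneg τ) (sq_nonneg σ)]
    nlinarith
  unfold sqrtRe
  apply Real.le_sqrt_of_sq_le
  rw [mul_pow, Real.sq_sqrt h0, hre]
  have h2 : (1 - τ ^ 2 / (s - σ) ^ 2) ^ 2 ≤ (s - σ) ^ 2 / ((s - σ) ^ 2 + τ ^ 2) := by
    have h3 : 1 - τ ^ 2 / (s - σ) ^ 2 ≤ (s - σ) ^ 2 / ((s - σ) ^ 2 + τ ^ 2) := by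
      rw [one_sub_div hd.ne', div_le_div_iff₀ hd hD]
      nlinarith [sq_nonneg (τ ^ 2)]
    have h4 : 1 - τ ^ 2 / (s - σ) ^ 2 ≤ 1 := by
      have : 0 ≤ τ ^ 2 / (s - σ) ^ 2 := by positivity
      linarith
    nlinarith
  calc _ ≤ (s + σ) / (s - σ) * ((s - σ) ^ 2 / ((s - σ) ^ 2 + τ ^ 2)) := by gcongr
    _ = (s ^ 2 - σ ^ 2) / ((s - σ) ^ 2 + τ ^ 2) := by field_simp; ring
    _ = ((s ^ 2 - σ ^ 2 + τ ^ 2) / ((s - σ) ^ 2 + τ ^ 2) +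
        (s ^ 2 - σ ^ 2 - τ ^ 2) / ((s - σ) ^ 2 + τ ^ 2)) / 2 := by field_simp; ring
    _ ≤ _ := by gcongr

/-- A smooth curve through `x`, transversal to the real axis, which `z ↦ 2z/(1+z²)` maps onto a
vertical line. -/
lemma exists_joukowski_curve {x : ℝ} (hx : |x| < 1) :
    ∃ φ : ℝ → ℂ, DifferentiableAt ℝ φ 0 ∧ φ 0 = x ∧ ∀ᶠ τ : ℝ in nhds 0,
      2 * φ τ / (1 + φ τ ^ 2) = (2 * x / (1 + x ^ 2) : ℝ) + τ * I := by
  set σ : ℝ := 2 * x / (1 + x ^ 2) with hσ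
  have hx2 : 0 < 1 + x ^ 2 := by positivity
  have hx1 : 0 < 1 - x ^ 2 := by nlinarith [abs_nonneg x, sq_abs x]
  have hσ1 : 1 - σ ^ 2 = ((1 - x ^ 2) / (1 + x ^ 2)) ^ 2 := by rw [hσ]; field_simp; ring
  let c : ℝ → ℂ := fun τ => (1 - ((σ : ℂ) + τ * I) ^ 2) ^ (2⁻¹ : ℂ)
  have h0 : (1 : ℂ) - ((σ : ℂ) + (0 : ℝ) * I) ^ 2 = ((1 - σ ^ 2 : ℝ) : ℂ) := by push_cast; ring
  have hpos : 0 < (1 - x ^ 2) / (1 + x ^ 2) := by positivity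
  have hsl : (1 : ℂ) - ((σ : ℂ) + (0 : ℝ) * I) ^ 2 ∈ slitPlane := by
    rw [h0, hσ1, ofReal_mem_slitPlane]; positivity
  have hc0 : c 0 = ((1 - x ^ 2) / (1 + x ^ 2) : ℝ) := by
    refine eq_of_sq_eq_of_re_pos ?_ (cpow_inv_two_re_pos hsl) (by rwa [ofReal_re])
    simp only [c]
    rw [cpow_inv_two_sq, h0, hσ1, ofReal_pow]
  have hin : HasDerivAt (fun τ : ℝ => 1 - ((σ : ℂ) + τ * I) ^ 2) _ 0 :=
    ((((hasDerivAt_id (0 : ℝ)).ofReal_comp.mul_const I).const_add (σ : ℂ)).pow 2).const_sub 1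
  have hcp : HasDerivAt (fun w : ℂ => w ^ (2⁻¹ : ℂ)) _ (1 - ((σ : ℂ) + (0 : ℝ) * I) ^ 2) :=
    (hasDerivAt_id _).cpow_const hsl
  have hcd : DifferentiableAt ℝ c 0 :=
    (HasDerivAt.comp (h₂ := fun w : ℂ => w ^ (2⁻¹ : ℂ)) (0 : ℝ) hcp hin).differentiableAt
  have hden : 1 + c 0 ≠ 0 := by
    rw [hc0, ← ofReal_one, ← ofReal_add, Ne, ofReal_eq_zero]; positivity
  refine ⟨fun τ => ((σ : ℂ) + τ * I) / (1 + c τ), ?_, ?_, ?_⟩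
  · refine DifferentiableAt.fun_div ?_ (hcd.const_add 1) hden
    exact (((hasDerivAt_id (0 : ℝ)).ofReal_comp.mul_const I).const_add (σ : ℂ)).differentiableAt
  · simp only [hc0]
    rw [ofReal_zero, zero_mul, add_zero, ← ofReal_one, ← ofReal_add, ← ofReal_div]
    congr 1
    rw [hσ]; field_simp; ring
  · have h1 : ∀ᶠ τ in nhds 0, 1 + c τ ≠ 0 :=
      (hcd.continuousAt.const_add 1).eventually_ne hden
    filter_upwards [h1] with τ h1
    have hsq : c τ ^ 2 = 1 - ((σ : ℂ) + τ * I) ^ 2 := cpow_inv_two_sq _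
    generalize (σ : ℂ) + τ * I = S at *
    have h2 : 1 + (S / (1 + c τ)) ^ 2 = 2 / (1 + c τ) := by
      field_simp
      linear_combination hsq
    rw [h2]
    field_simp

lemma two_mul_div_sub {t x : ℝ} : 2 * t / (1 + t ^ 2) - 2 * x / (1 + x ^ 2) =
    2 * ((t - x) * (1 - t * x)) / ((1 + t ^ 2) * (1 + x ^ 2)) := by
  have : 1 + t ^ 2 ≠ 0 := by positivity
  have : 1 + x ^ 2 ≠ 0 := by positivity
  field_simp; ring

lemma comparisonFn_curve {L : Set ℝ} (hL : IsCompact L) {x : ℝ} (hx : |x| < 1)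
    (hxL : (x : ℂ) ∈ regularSet L) {φ : ℝ → ℂ} (hφc : ContinuousAt φ 0) (hφ0 : φ 0 = x)
    (hφ : ∀ᶠ τ : ℝ in nhds 0, 2 * φ τ / (1 + φ τ ^ 2) = (2 * x / (1 + x ^ 2) : ℝ) + τ * I) :
    ∃ C, ∀ᶠ τ in nhds 0, comparisonFn L x - C * τ ^ 2 ≤ comparisonFn L (φ τ) := by
  set σ : ℝ := 2 * x / (1 + x ^ 2) with hσ
  have hne : ∀ t ∈ L, 2 * t / (1 + t ^ 2) ≠ σ := by
    intro t ht h
    have h1 := hxL t ht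
    have h2 := two_mul_div_sub (t := t) (x := x)
    rw [h, ← hσ, sub_self, eq_comm, div_eq_zero_iff] at h2
    rcases h2 with h2 | h2
    · apply h1
      have : (t - x) * (1 - t * x) = 0 := by linarith
      exact_mod_cast this
    · have : (1 + t ^ 2) * (1 + x ^ 2) ≠ 0 := by positivity
      exact this h2
  have hcs : Continuous fun t : ℝ => (2 * t / (1 + t ^ 2) - σ) ^ 2 :=
    ((Continuous.div (by fun_prop) (by fun_prop) (fun t => by positivity)).sub
      continuous_const).pow 2
  obtain ⟨a, ha, hab⟩ : ∃ a > 0, ∀ t ∈ L, a ≤ (2 * t / (1 + t ^ 2) - σ) ^ 2 := by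
    rcases L.eq_empty_or_nonempty with rfl | hLn
    · exact ⟨1, one_pos, by simp⟩
    · obtain ⟨t₀, ht₀, hmin⟩ := hL.exists_isMinOn hLn hcs.continuousOn
      have := sub_ne_zero.2 (hne t₀ ht₀)
      exact ⟨_, by positivity, fun t ht => hmin ht⟩
  refine ⟨comparisonFn L x / a, ?_⟩
  have hreg : ∀ᶠ τ in nhds 0, φ τ ∈ regularSet L := hφc.eventually_mem
    (by rw [hφ0]; exact (isOpen_regularSet hL).mem_nhds hxL)
  have hnorm : ∀ᶠ τ in nhds 0, φ τ ∈ ball (0 : ℂ) 1 := hφc.eventually_mem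
    (by rw [hφ0]; exact isOpen_ball.mem_nhds (by simpa using hx))
  filter_upwards [hφ, hreg, hnorm] with τ h1 h2 h3
  rw [mem_ball_zero_iff] at h3
  have e : comparisonFn L x - comparisonFn L x / a * τ ^ 2 =
      ∫ t in L, (sqrtRe (slitKernel t x) * arctanDensity t) * (1 - τ ^ 2 / a) := by
    rw [integral_mul_const, comparisonFn]; ring
  rw [e]
  refine setIntegral_mono_on ((integrableOn_kernel hL hxL).mul_const _)
    (integrableOn_kernel hL h2) hL.measurableSet fun t ht => ?_
  have hk := sqrtRe_div_mul_le τ (hne t ht)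
  have hx' : ‖(x : ℂ)‖ < 1 := by simpa using hx
  have hSx : 2 * (x : ℂ) / (1 + (x : ℂ) ^ 2) = (σ : ℝ) := by rw [hσ]; push_cast; rfl
  rw [slitKernel_eq_div t (one_add_sq_ne_zero h3), h1,
    slitKernel_eq_div t (one_add_sq_ne_zero hx'), hSx, mul_right_comm]
  refine mul_le_mul_of_nonneg_right (le_trans ?_ hk) (arctanDensity_pos t).le
  refine mul_le_mul_of_nonneg_left ?_ (sqrtRe_nonneg _)
  have := hab t ht
  gcongr

lemma abs_le_of_joukowski {x : ℝ} (hx : |x| < 1) {φ : ℝ → ℂ} (hφc : ContinuousAt φ 0)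
    (hφ0 : φ 0 = x)
    (hφ : ∀ᶠ τ : ℝ in nhds 0, 2 * φ τ / (1 + φ τ ^ 2) = (2 * x / (1 + x ^ 2) : ℝ) + τ * I) :
    ∀ᶠ τ in nhds 0, |τ| ≤ 8 * |(φ τ).im| := by
  have hnorm : ∀ᶠ τ in nhds 0, φ τ ∈ ball (0 : ℂ) 1 := hφc.eventually_mem
    (by rw [hφ0]; exact isOpen_ball.mem_nhds (by simpa using hx))
  have hq : ∀ᶠ τ in nhds 0, 1 / 4 < normSq (1 + φ τ ^ 2) := by
    have hc : ContinuousAt (fun τ => normSq (1 + φ τ ^ 2)) 0 :=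
      continuous_normSq.continuousAt.comp (by fun_prop)
    refine hc.eventually_const_lt ?_
    simp only [hφ0]
    rw [← ofReal_pow, ← ofReal_one, ← ofReal_add, normSq_ofReal]
    nlinarith [sq_nonneg x]
  filter_upwards [hφ, hnorm, hq] with τ h1 h2 h3
  rw [mem_ball_zero_iff] at h2
  have him := congrArg im h1
  rw [im_joukowski, add_im, ofReal_im, zero_add, im_ofReal_mul, I_im, mul_one] at him
  have ha : |τ| = |2 * (φ τ).im * (1 - ‖φ τ‖ ^ 2) / normSq (1 + φ τ ^ 2)| := by rw [him]
  rw [ha, abs_div, abs_mul, abs_mul, abs_of_pos (by linarith : 0 < normSq (1 + φ τ ^ 2)),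
    div_le_iff₀ (by linarith)]
  have h4 : |1 - ‖φ τ‖ ^ 2| ≤ 1 := by
    rw [abs_le]; constructor <;> nlinarith [norm_nonneg (φ τ)]
  have h5 := abs_nonneg (φ τ).im
  rw [abs_two]
  nlinarith [abs_nonneg (1 - ‖φ τ‖ ^ 2)]

lemma not_eventually_abs_add_le {G : ℝ → ℝ} (hG : DifferentiableAt ℝ G 0) {a C : ℝ} (ha : 0 < a) :
    ¬ ∀ᶠ τ in nhds 0, a * |τ| - C * τ ^ 2 + G τ ≤ G 0 := by
  intro h
  set H : ℝ → ℝ := fun τ => G τ - C * τ ^ 2 with hH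
  have hHd : DifferentiableAt ℝ H 0 := by fun_prop
  have hH0 : H 0 = G 0 := by simp [hH]
  have hle : ∀ᶠ τ in nhds 0, H τ ≤ H 0 - a * |τ| := by
    filter_upwards [h] with τ h; simp only [hH0]; simp only [hH]; linarith
  have hmax : IsLocalMax H 0 := by
    filter_upwards [hle] with τ h
    have := mul_nonneg ha.le (abs_nonneg τ)
    linarith
  have hd := hHd.hasDerivAt
  rw [hmax.deriv_eq_zero, hasDerivAt_iff_isLittleO] at hd
  have h2 := hd.def (half_pos ha)
  have h3 : ∀ᶠ τ : ℝ in nhdsWithin 0 {0}ᶜ, False := by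
    filter_upwards [nhdsWithin_le_nhds hle, nhdsWithin_le_nhds h2, self_mem_nhdsWithin]
      with τ h1 h2 h3
    simp only [sub_zero, smul_zero, Real.norm_eq_abs] at h2
    have := (abs_le.1 h2).1
    have := mul_pos ha (abs_pos.2 h3)
    linarith
  simpa using h3.exists

lemma nonpos_of_not_isLocalMax {U : Set ℂ} (hUo : IsOpen U) (hUb : Bornology.IsBounded U)
    {d : ℂ → ℝ} (hd : ContinuousOn d U)
    (hb : ∀ ζ ∈ frontier U, ∀ c > 0, ∀ᶠ z in nhdsWithin ζ U, d z < c)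
    (hmax : ∀ z ∈ U, ¬ IsLocalMax d z) {z : ℂ} (hz : z ∈ U) : d z ≤ 0 := by
  by_contra! hpos
  set A := {w ∈ U | d z ≤ d w} with hA
  have hAc : IsClosed A := by
    refine isClosed_of_closure_subset fun ζ hζ => ?_
    have hfr : ∃ᶠ w in nhdsWithin ζ U, d z ≤ d w := by
      rw [mem_closure_iff_frequently] at hζ
      rw [frequently_nhdsWithin_iff]
      exact hζ.mono fun w hw => ⟨hw.2, hw.1⟩
    have hζU : ζ ∈ U := by
      by_contra hn
      have h1 : ζ ∈ frontier U := by
        rw [hUo.frontier_eq]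
        exact ⟨closure_mono (fun w hw => hw.1) hζ, hn⟩
      exact hfr ((hb ζ h1 _ hpos).mono fun w hw => not_le.2 hw)
    exact ⟨hζU, ge_of_tendsto_of_frequently (hd ζ hζU) hfr⟩
  have hAcomp : IsCompact A := isCompact_of_isClosed_isBounded hAc (hUb.subset fun w hw => hw.1)
  obtain ⟨w, hw, hwmax⟩ := hAcomp.exists_isMaxOn ⟨z, hz, le_rfl⟩ (hd.mono fun w hw => hw.1)
  refine hmax w hw.1 ?_
  filter_upwards [hUo.mem_nhds hw.1] with y hy
  by_cases h : d z ≤ d y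
  · exact hwmax ⟨hy, h⟩
  · exact (not_le.1 h).le.trans hw.2

lemma not_isLocalMax_of_im_ne_zero {L : Set ℝ} (hL : IsCompact L) (hL1 : L ⊆ Icc (-1) 1)
    (h0 : (0 : ℝ) ∉ L) {ω : ℂ → ℝ} {z : ℂ} (hz : ‖z‖ < 1) (him : z.im ≠ 0)
    (hzL : z ∈ regularSet L) (hω : InnerProductSpace.HarmonicAt ω z) {ε η : ℝ} (hε : 0 < ε) :
    ¬ IsLocalMax (fun z => comparisonFn L z - ω z + η * (|z.im| - 1) + ε * (‖z‖ ^ 2 - 1)) z := by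
  intro hmax
  obtain ⟨sg, hsg⟩ : ∃ sg : ℝ, ∀ᶠ w in nhds z, |w.im| = sg * w.im := by
    rcases him.lt_or_gt with h | h
    · refine ⟨-1, ?_⟩
      filter_upwards [(isOpen_lt continuous_im continuous_const).mem_nhds h] with w hw
      rw [abs_of_neg hw]; ring
    · refine ⟨1, ?_⟩
      filter_upwards [(isOpen_lt continuous_const continuous_im).mem_nhds h] with w hw
      rw [abs_of_pos hw]; ring
  have hlin : AnalyticAt ℂ (fun w => 2 * ε * starRingEnd ℂ z * w - η * sg * I * w) z := by fun_prop
  set g : ℂ → ℝ := (fun w => (2 * ε * starRingEnd ℂ z * w - η * sg * I * w).re) - ω with hg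
  have hgh : InnerProductSpace.HarmonicAt g z := hlin.harmonicAt_re.sub hω
  have hre : ∀ w : ℂ, (2 * ε * starRingEnd ℂ z * w - η * sg * I * w).re =
      2 * ε * (z.re * w.re + z.im * w.im) + η * (sg * w.im) := by
    intro w; simp; ring
  have hnhds : ∀ᶠ w in nhds z, InnerProductSpace.HarmonicAt g w ∧ |w.im| = sg * w.im ∧
      w ∈ regularSet L ∩ {w | ‖w‖ < 1 ∧ w.im ≠ 0} ∧
      comparisonFn L w - ω w + η * (|w.im| - 1) + ε * (‖w‖ ^ 2 - 1) ≤
        comparisonFn L z - ω z + η * (|z.im| - 1) + ε * (‖z‖ ^ 2 - 1) := by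
    filter_upwards [hgh.eventually, hsg,
      (isOpen_regularSet hL).mem_nhds hzL, continuous_norm.continuousAt.eventually_lt_const hz,
      continuous_im.continuousAt.eventually_ne him, hmax] with w h1 h2 h3 h4 h5 h6
    exact ⟨h1, h2, ⟨h3, h4, h5⟩, h6⟩
  obtain ⟨R, hR, hball⟩ := Metric.nhds_basis_closedBall.eventually_iff.1 hnhds
  have hgb : InnerProductSpace.HarmonicOnNhd g (closedBall z |R|) := by
    rw [abs_of_pos hR]; exact fun w hw => (hball hw).1
  have hcv := circleAverage_comparisonFn hL hL1 h0 hR.le (fun w hw => (hball hw).2.2.1)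
  have hcg := hgb.circleAverage_eq
  have hsub : sphere z |R| ⊆ closedBall z R := by
    rw [abs_of_pos hR]; exact sphere_subset_closedBall
  have hvi : CircleIntegrable (comparisonFn L) z R := by
    refine ContinuousOn.circleIntegrable' fun w hw => ?_
    exact (continuousAt_comparisonFn hL (hball (hsub hw)).2.2.1.1).continuousWithinAt
  have hgi : CircleIntegrable g z R :=
    (hgb.continuousOn.mono sphere_subset_closedBall).circleIntegrable'
  have hadd := Real.circleAverage_add hvi hgi
  have hle : Real.circleAverage (comparisonFn L + g) z R ≤
      comparisonFn L z + g z - ε * R ^ 2 := by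
    refine Real.circleAverage_mono_on_of_le_circle (hvi.add hgi) fun w hw => ?_
    obtain ⟨-, h2, -, h4⟩ := hball (hsub hw)
    have h2z := (hball (mem_closedBall_self hR.le)).2.1
    have hd : ‖w - z‖ ^ 2 = R ^ 2 := by
      rw [mem_sphere_iff_norm, abs_of_pos hR] at hw; rw [hw]
    rw [h2, h2z] at h4
    simp only [Pi.add_apply, hg, Pi.sub_apply, hre]
    rw [← normSq_eq_norm_sq, normSq_apply, sub_re, sub_im] at hd
    rw [← normSq_eq_norm_sq, normSq_apply, ← normSq_eq_norm_sq, normSq_apply] at h4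
    rw [← hd]
    nlinarith
  rw [hadd, hcv, hcg] at hle
  have : 0 < ε * R ^ 2 := by positivity
  linarith

lemma not_isLocalMax_ofReal {L : Set ℝ} (hL : IsCompact L) {ω : ℂ → ℝ} {x : ℝ} (hx : |x| < 1)
    (hxL : (x : ℂ) ∈ regularSet L) (hω : DifferentiableAt ℝ ω x) {ε η : ℝ} (hη : 0 < η) :
    ¬ IsLocalMax (fun z => comparisonFn L z - ω z + η * (|z.im| - 1) + ε * (‖z‖ ^ 2 - 1)) x := by
  intro hmax
  obtain ⟨φ, hφd, hφ0, hφ⟩ := exists_joukowski_curve hx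
  obtain ⟨C, hC⟩ := comparisonFn_curve hL hx hxL hφd.continuousAt hφ0 hφ
  have him := abs_le_of_joukowski hx hφd.continuousAt hφ0 hφ
  have hω' : DifferentiableAt ℝ ω (φ 0) := by rwa [hφ0]
  have hωφ : DifferentiableAt ℝ (fun τ => ω (φ τ)) 0 := hω'.comp 0 hφd
  have hGd : DifferentiableAt ℝ (fun τ => ε * ‖φ τ‖ ^ 2 - ω (φ τ)) 0 :=
    ((hφd.norm_sq ℝ).const_mul ε).sub hωφ
  refine not_eventually_abs_add_le hGd (a := η / 8) (C := C) (by positivity) ?_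
  have hm : ∀ᶠ τ in nhds (0 : ℝ), _ := hφd.continuousAt.eventually (by rw [hφ0]; exact hmax)
  filter_upwards [hC, him, hm] with τ h1 h2 h3
  rw [hφ0]
  rw [ofReal_im, abs_zero] at h3
  nlinarith

/-- Comparison of the harmonic measure at the origin with the law of density `arctanDensity`. -/
theorem setIntegral_arctanDensity_le {K : Set ℝ} (hK : IsClosed K) (h0 : (0 : ℝ) ∉ K)
    {ω : ℂ → ℝ} (hω : ∀ z ∈ ball (0 : ℂ) 1 \ ofReal '' K, InnerProductSpace.HarmonicAt ω z)
    (hω0 : ∀ z ∈ ball (0 : ℂ) 1 \ ofReal '' K, 0 ≤ ω z)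
    (hω1 : ∀ ζ ∈ ofReal '' K ∩ ball (0 : ℂ) 1,
      Tendsto ω (nhdsWithin ζ (ball (0 : ℂ) 1 \ ofReal '' K)) (nhds 1))
    {ρ : ℝ} (hρ : ρ < 1) : ∫ t in K ∩ Icc (-ρ) ρ, arctanDensity t ≤ ω 0 := by
  set L := K ∩ Icc (-ρ) ρ with hLdef
  set U := ball (0 : ℂ) 1 \ ofReal '' K with hU
  have hL : IsCompact L := isCompact_Icc.inter_left hK
  have hLρ : L ⊆ Icc (-ρ) ρ := inter_subset_right
  have hL1 : L ⊆ Icc (-1) 1 := hLρ.trans (Icc_subset_Icc (by linarith) hρ.le)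
  have h0L : (0 : ℝ) ∉ L := fun h => h0 h.1
  have hKc : IsClosed (ofReal '' K) := isometry_ofReal.isClosedEmbedding.isClosedMap _ hK
  have hUo : IsOpen U := isOpen_ball.sdiff hKc
  have hreg : ∀ z, ‖z‖ ≤ 1 → z ∉ ofReal '' K → z ∈ regularSet L := fun z hz hzK =>
    mem_regularSet hρ hLρ hz fun h => hzK (image_mono inter_subset_left h)
  have hregU : ∀ z ∈ U, z ∈ regularSet L := fun z hz =>
    hreg z (mem_ball_zero_iff.1 hz.1).le hz.2
  have hkey : ∀ ε : ℝ, 0 < ε → comparisonFn L 0 ≤ ω 0 + 2 * ε := by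
    intro ε hε
    set d : ℂ → ℝ := fun z => comparisonFn L z - ω z + ε * (|z.im| - 1) + ε * (‖z‖ ^ 2 - 1) with hd
    have h0U : (0 : ℂ) ∈ U := by
      refine ⟨mem_ball_self one_pos, ?_⟩
      rintro ⟨t, ht, h⟩
      rw [ofReal_eq_zero] at h
      exact h0 (h ▸ ht)
    have hneg : ∀ z ∈ U, ε * (|z.im| - 1) ≤ 0 ∧ ε * (‖z‖ ^ 2 - 1) ≤ 0 := by
      intro z hz
      have h1 := mem_ball_zero_iff.1 hz.1
      have h2 := abs_im_le_norm z
      constructor <;> apply mul_nonpos_of_nonneg_of_nonpos hε.le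
      · linarith
      · nlinarith [norm_nonneg z]
    suffices hd0 : d 0 ≤ 0 by
      simp only [hd, zero_im, abs_zero, norm_zero] at hd0
      linarith
    refine nonpos_of_not_isLocalMax hUo (isBounded_ball.subset sdiff_subset) ?_ ?_ ?_ h0U
    · refine ((ContinuousOn.sub ?_ ?_).add (by fun_prop)).add (by fun_prop)
      · exact fun z hz => (continuousAt_comparisonFn hL (hregU z hz)).continuousWithinAt
      · exact fun z hz => (hω z hz).1.continuousAt.continuousWithinAt
    · intro ζ hζ c hc
      rw [hUo.frontier_eq] at hζ
      have hζ1 : ‖ζ‖ ≤ 1 := by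
        have := closure_ball_subset_closedBall (closure_mono sdiff_subset hζ.1)
        rwa [mem_closedBall_zero_iff] at this
      by_cases hζK : ζ ∈ ofReal '' K ∩ ball (0 : ℂ) 1
      · filter_upwards [(hω1 ζ hζK).eventually_const_lt (by linarith : 1 - c < 1),
          self_mem_nhdsWithin] with z h1 h2
        have h3 := comparisonFn_le_one hL hL1 (mem_ball_zero_iff.1 h2.1) (hregU z h2)
        have := hneg z h2
        simp only [hd]; linarith
      · have hζn : ‖ζ‖ = 1 := by
          refine le_antisymm hζ1 (not_lt.1 fun hlt => ?_)
          have hb := mem_ball_zero_iff.2 hlt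
          exact hζ.2 ⟨hb, fun h => hζK ⟨h, hb⟩⟩
        have hζL : ζ ∈ regularSet L := by
          refine mem_regularSet hρ hLρ hζ1 ?_
          rintro ⟨t, ht, rfl⟩
          have := abs_le.2 (hLρ ht)
          rw [norm_real, Real.norm_eq_abs] at hζn
          linarith
        have hlim := (continuousAt_comparisonFn hL hζL).tendsto.mono_left
          (nhdsWithin_le_nhds (s := U))
        rw [comparisonFn_of_norm_eq_one L hζn] at hlim
        filter_upwards [hlim.eventually_lt_const hc, self_mem_nhdsWithin] with z h1 h2
        have := hneg z h2
        have := hω0 z h2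
        simp only [hd]; linarith
    · intro z hz
      have hz1 := mem_ball_zero_iff.1 hz.1
      by_cases him : z.im = 0
      · obtain ⟨x, rfl⟩ : ∃ x : ℝ, (x : ℂ) = z := ⟨z.re, Complex.ext rfl (by simp [him])⟩
        rw [norm_real, Real.norm_eq_abs] at hz1
        exact not_isLocalMax_ofReal hL hz1 (hregU _ hz)
          ((hω _ hz).1.differentiableAt two_ne_zero) hε
      · exact not_isLocalMax_of_im_ne_zero hL hL1 h0L hz1 him (hregU z hz) (hω z hz) hε
  rw [← comparisonFn_zero hL.measurableSet h0L]
  refine le_of_forall_pos_le_add fun ε hε => ?_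
  have := hkey (ε / 2) (half_pos hε)
  linarith

lemma laplacian_eq_planarLaplacian {u : ℂ → ℝ} {z : ℂ} (hu : ContDiffAt ℝ 2 u z) :
    Laplacian.laplacian u z = planarLaplacian u z := by
  have hd : DifferentiableAt ℝ (fderiv ℝ u) z :=
    (hu.fderiv_right (m := 1) (by norm_num)).differentiableAt one_ne_zero
  have h : ∀ v : ℂ, fderiv ℝ (fun w => fderiv ℝ u w v) z v = fderiv ℝ (fderiv ℝ u) z v v := by
    intro v
    rw [fderiv_clm_apply hd (differentiableAt_const v)]
    simp
  rw [InnerProductSpace.laplacian_eq_iteratedFDeriv_complexPlane, planarLaplacian, h, h]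
  simp [iteratedFDeriv_two_apply]

lemma HarmonicOnSet.harmonicAt {u : ℂ → ℝ} {U : Set ℂ} (hU : IsOpen U) (hu : HarmonicOnSet u U)
    {z : ℂ} (hz : z ∈ U) : InnerProductSpace.HarmonicAt u z := by
  refine ⟨hu.1.contDiffAt (hU.mem_nhds hz), ?_⟩
  filter_upwards [hU.mem_nhds hz] with w hw
  rw [laplacian_eq_planarLaplacian (hu.1.contDiffAt (hU.mem_nhds hw)), hu.2 w hw]
  rfl

lemma harmonicAt_comp_analyticAt {u : ℂ → ℝ} {f : ℂ → ℂ} {z : ℂ}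
    (hu : InnerProductSpace.HarmonicAt u (f z)) (hf : AnalyticAt ℂ f z) :
    InnerProductSpace.HarmonicAt (fun w => u (f w)) z := by
  obtain ⟨R, hR, hball⟩ := Metric.nhds_basis_ball.eventually_iff.1 hu.eventually
  obtain ⟨F, hF, hFu⟩ := InnerProductSpace.HarmonicOnNhd.exists_analyticOnNhd_ball_re_eq
    (fun w hw => hball hw : InnerProductSpace.HarmonicOnNhd u (ball (f z) R))
  have hFf : AnalyticAt ℂ (fun w => F (f w)) z := (hF (f z) (mem_ball_self hR)).comp hf
  refine (InnerProductSpace.harmonicAt_congr_nhds ?_).1 hFf.harmonicAt_re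
  filter_upwards [hf.continuousAt.eventually_mem (ball_mem_nhds _ hR)] with w hw
  exact hFu hw

lemma integral_arctanDensity (a b : ℝ) :
    ∫ t in a..b, arctanDensity t = 2 / Real.pi * (Real.arctan b - Real.arctan a) := by
  rw [← integral_inv_one_add_sq, ← intervalIntegral.integral_const_mul]
  congr 1
  ext t
  rw [arctanDensity, div_mul_eq_div_div, div_eq_mul_inv]

lemma arctanDensity_le_one (t : ℝ) : arctanDensity t ≤ 1 := by
  have := Real.pi_gt_three
  rw [arctanDensity, div_le_one (by positivity)]
  nlinarith [mul_nonneg (sq_nonneg t) Real.pi_pos.le]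

lemma arctanDensity_le_of_abs_le {s t : ℝ} (h : |s| ≤ |t|) : arctanDensity t ≤ arctanDensity s := by
  have := Real.pi_pos
  have := sq_le_sq.2 h
  unfold arctanDensity
  gcongr

/-- Among the subsets of `[-1, 1]` of measure `2(1 - δ)`, the integral of `arctanDensity` is
minimal for `[-1, -δ] ∪ [δ, 1]`. -/
lemma le_setIntegral_arctanDensity {K : Set ℝ} (hK : IsClosed K) (hK1 : K ⊆ Icc (-1) 1) {δ : ℝ}
    (hδ0 : 0 < δ) (hδ1 : δ < 1) (hvol : 2 * (1 - δ) ≤ volume.real K) :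
    1 - 4 / Real.pi * Real.arctan δ ≤ ∫ t in K, arctanDensity t := by
  set c := arctanDensity δ with hc
  have hKc : IsCompact K := isCompact_Icc.of_isClosed_subset hK hK1
  have hcont : Continuous fun t => arctanDensity t - c :=
    continuous_arctanDensity.sub continuous_const
  set A : Set ℝ := Icc (-1) (-δ) ∪ Icc δ 1 with hA
  have hAc : IsCompact A := isCompact_Icc.union isCompact_Icc
  have hmem : ∀ t ∈ A, δ ≤ |t| := by
    rintro t (ht | ht)
    · exact le_abs.2 (Or.inr (by linarith [ht.2]))
    · exact le_abs.2 (Or.inl ht.1)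
  have hle : ∫ t in A, (arctanDensity t - c) ≤ ∫ t in K, (arctanDensity t - c) := by
    rw [← integral_indicator hAc.measurableSet, ← integral_indicator hK.measurableSet]
    refine integral_mono (hcont.continuousOn.integrableOn_compact hAc |>.integrable_indicator
      hAc.measurableSet) (hcont.continuousOn.integrableOn_compact hKc |>.integrable_indicator
      hK.measurableSet) fun t => ?_
    by_cases htK : t ∈ K <;> by_cases htA : t ∈ A
    · simp [htK, htA]
    · simp only [htK, htA, indicator_of_mem, indicator_of_notMem, not_false_eq_true, sub_nonneg]
      refine arctanDensity_le_of_abs_le ?_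
      rw [abs_of_pos hδ0]
      by_contra! h
      have h1 := hK1 htK
      rcases lt_abs.1 h with h | h
      · exact htA (Or.inr ⟨h.le, h1.2⟩)
      · exact htA (Or.inl ⟨h1.1, by linarith⟩)
    · simp only [htK, htA, indicator_of_mem, indicator_of_notMem, not_false_eq_true, sub_nonpos]
      exact arctanDensity_le_of_abs_le (by rw [abs_of_pos hδ0]; exact hmem t htA)
    · simp [htK, htA]
  have hii : ∀ a b : ℝ, IntervalIntegrable arctanDensity volume a b := fun a b =>
    continuous_arctanDensity.intervalIntegrable a b
  have hAint : ∫ t in A, (arctanDensity t - c) =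
      1 - 4 / Real.pi * Real.arctan δ - 2 * (1 - δ) * c := by
    rw [hA, setIntegral_union ?_ measurableSet_Icc
      (hcont.continuousOn.integrableOn_compact isCompact_Icc)
      (hcont.continuousOn.integrableOn_compact isCompact_Icc), integral_Icc_eq_integral_Ioc,
      integral_Icc_eq_integral_Ioc, ← intervalIntegral.integral_of_le (by linarith),
      ← intervalIntegral.integral_of_le hδ1.le,
      intervalIntegral.integral_sub (hii _ _) intervalIntegrable_const,
      intervalIntegral.integral_sub (hii _ _) intervalIntegrable_const,
      integral_arctanDensity, integral_arctanDensity]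
    · simp only [intervalIntegral.integral_const, smul_eq_mul, Real.arctan_neg, Real.arctan_one]
      have := Real.pi_ne_zero
      field_simp
      ring
    · rw [Set.disjoint_left]
      intro t h1 h2
      linarith [h1.2, h2.1]
  have hKint : ∫ t in K, (arctanDensity t - c) =
      (∫ t in K, arctanDensity t) - volume.real K * c := by
    rw [integral_sub (continuous_arctanDensity.continuousOn.integrableOn_compact hKc)
      (integrableOn_const hKc.measure_lt_top.ne), setIntegral_const, smul_eq_mul]
  have := mul_le_mul_of_nonneg_right hvol (arctanDensity_pos δ).le
  rw [← hc] at this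
  rw [hAint, hKint] at hle
  linarith

lemma setIntegral_arctanDensity_le_add {K : Set ℝ} (hK : IsClosed K) (hK1 : K ⊆ Icc (-1) 1) {ε : ℝ}
    (hε : 0 ≤ ε) : ∫ t in K, arctanDensity t ≤
      (∫ t in K ∩ Icc (-(1 - ε)) (1 - ε), arctanDensity t) + 2 * ε := by
  have hKc : IsCompact K := isCompact_Icc.of_isClosed_subset hK hK1
  have hi := continuous_arctanDensity.continuousOn.integrableOn_compact (μ := volume) hKc
  rw [← integral_inter_add_sdiff (measurableSet_Icc (a := -(1 - ε)) (b := 1 - ε)) hi]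
  gcongr
  have hsub : K \ Icc (-(1 - ε)) (1 - ε) ⊆ Icc (-1) (-(1 - ε)) ∪ Icc (1 - ε) 1 := by
    intro t ht
    have h1 := hK1 ht.1
    rcases lt_or_ge t (-(1 - ε)) with h | h
    · exact Or.inl ⟨h1.1, h.le⟩
    · exact Or.inr ⟨not_lt.1 fun h2 => ht.2 ⟨h, h2.le⟩, h1.2⟩
  have hfin : volume (Icc (-1) (-(1 - ε)) ∪ Icc (1 - ε) 1) ≠ ⊤ :=
    (isCompact_Icc.union isCompact_Icc).measure_lt_top.ne
  calc ∫ t in K \ Icc (-(1 - ε)) (1 - ε), arctanDensity t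
      ≤ ∫ t in K \ Icc (-(1 - ε)) (1 - ε), (1 : ℝ) :=
        setIntegral_mono (hi.mono_set sdiff_subset)
          (integrableOn_const (measure_ne_top_of_subset hsub hfin)) arctanDensity_le_one
    _ = volume.real (K \ Icc (-(1 - ε)) (1 - ε)) := by simp
    _ ≤ volume.real (Icc (-1) (-(1 - ε)) ∪ Icc (1 - ε) 1) := measureReal_mono hsub hfin
    _ ≤ volume.real (Icc (-1) (-(1 - ε))) + volume.real (Icc (1 - ε) 1) :=
        measureReal_union_le _ _
    _ = 2 * ε := by
        rw [Real.volume_real_Icc_of_le (by linarith), Real.volume_real_Icc_of_le (by linarith)]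
        ring

lemma arcsin_one_sub_sq_div {δ : ℝ} (hδ : 0 ≤ δ) :
    Real.arcsin ((1 - δ ^ 2) / (1 + δ ^ 2)) = Real.pi / 2 - 2 * Real.arctan δ := by
  have h1 := Real.arctan_nonneg.2 hδ
  have h2 := Real.arctan_lt_pi_div_two δ
  have : (1 - δ ^ 2) / (1 + δ ^ 2) = Real.sin (Real.pi / 2 - 2 * Real.arctan δ) := by
    rw [Real.sin_pi_div_two_sub, Real.cos_two_mul, Real.cos_sq_arctan]
    field_simp
    ring
  rw [this, Real.arcsin_sin] <;> linarith

lemma le_harmonicMeasure_of_unit_disk {δ : ℝ} (hδ0 : 0 < δ) (hδ1 : δ < 1) {K : Set ℝ}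
    (hK : IsClosed K) (hK1 : K ⊆ Icc (-1) 1) (hvol : 2 * (1 - δ) ≤ volume.real K)
    (h0 : (0 : ℝ) ∉ K) {ω : ℂ → ℝ}
    (hω : ∀ z ∈ ball (0 : ℂ) 1 \ ofReal '' K, InnerProductSpace.HarmonicAt ω z)
    (hω0 : ∀ z ∈ ball (0 : ℂ) 1 \ ofReal '' K, 0 ≤ ω z)
    (hω1 : ∀ ζ ∈ ofReal '' K ∩ ball (0 : ℂ) 1,
      Tendsto ω (nhdsWithin ζ (ball (0 : ℂ) 1 \ ofReal '' K)) (nhds 1)) :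
    2 / Real.pi * Real.arcsin ((1 - δ ^ 2) / (1 + δ ^ 2)) ≤ ω 0 := by
  rw [arcsin_one_sub_sq_div hδ0.le]
  have h1 := le_setIntegral_arctanDensity hK hK1 hδ0 hδ1 hvol
  have h2 : ∫ t in K, arctanDensity t ≤ ω 0 := by
    refine le_of_forall_pos_le_add fun ε hε => ?_
    have h3 := setIntegral_arctanDensity_le_add hK hK1 (half_pos hε).le
    have h4 := setIntegral_arctanDensity_le hK h0 hω hω0 hω1 (by linarith : 1 - ε / 2 < 1)
    linarith
  refine le_trans (le_of_eq ?_) (h1.trans h2)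
  have := Real.pi_ne_zero
  field_simp
  ring

/-- Scaled sparseness estimate on the harmonic measure: for a closed
`K ⊆ [−r,r]` with `|K| ≥ 2r(1−δ)` and `0 ∉ K`, and a harmonic measure function
`ω` of `K` (regarded as a subset of `ℂ`) with respect to the disk `D_r` of
radius `r`, one has `ω(0) ≥ (2/π)·arcsin((1−δ²)/(1+δ²))`. -/
theorem scaled_sparseness_harmonic_measure
    (r δ : ℝ) (hr : 0 < r) (hδ0 : 0 < δ) (hδ1 : δ < 1)
    (K : Set ℝ) (hKclosed : IsClosed K) (hKsub : K ⊆ Set.Icc (-r) r)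
    (hKmeas : ENNReal.ofReal (2 * r * (1 - δ)) ≤ volume K)
    (h0K : (0 : ℝ) ∉ K)
    (ω : ℂ → ℝ)
    (hω : IsHarmonicMeasureFn ω (Metric.ball (0 : ℂ) r) (Complex.ofReal '' K)) :
    2 / Real.pi * Real.arcsin ((1 - δ ^ 2) / (1 + δ ^ 2)) ≤ ω 0 := by
  obtain ⟨hharm, hbd, hone, -⟩ := hω
  set U := Metric.ball (0 : ℂ) r \ Complex.ofReal '' K with hU
  have hUo : IsOpen U :=
    isOpen_ball.sdiff (isometry_ofReal.isClosedEmbedding.isClosedMap _ hKclosed)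
  set K' : Set ℝ := (fun t => r * t) ⁻¹' K with hK'
  have hK'c : IsClosed K' := hKclosed.preimage (by fun_prop)
  have hK'1 : K' ⊆ Icc (-1) 1 := by
    intro t ht
    obtain ⟨h1, h2⟩ := hKsub ht
    constructor <;> nlinarith
  have hball : ∀ z : ℂ, z ∈ ball (0 : ℂ) 1 ↔ r * z ∈ ball (0 : ℂ) r := by
    intro z
    rw [mem_ball_zero_iff, mem_ball_zero_iff, norm_mul, norm_real, Real.norm_eq_abs, abs_of_pos hr]
    exact (mul_lt_iff_lt_one_right hr).symm
  have hmem : ∀ z : ℂ, z ∈ ofReal '' K' ↔ r * z ∈ ofReal '' K := by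
    intro z
    constructor
    · rintro ⟨t, ht, rfl⟩
      exact ⟨r * t, ht, ofReal_mul r t⟩
    · rintro ⟨t, ht, h⟩
      refine ⟨t / r, ?_, ?_⟩
      · change r * (t / r) ∈ K
        rwa [mul_div_cancel₀ _ hr.ne']
      · have hr' : (r : ℂ) ≠ 0 := ofReal_ne_zero.2 hr.ne'
        rw [ofReal_div, h, mul_div_cancel_left₀ _ hr']
  have hUmem : ∀ z, z ∈ ball (0 : ℂ) 1 \ ofReal '' K' → r * z ∈ U := fun z hz =>
    ⟨(hball z).1 hz.1, fun h => hz.2 ((hmem z).2 h)⟩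
  have hvol : 2 * (1 - δ) ≤ volume.real K' := by
    have hfin : volume K ≠ ⊤ := measure_ne_top_of_subset hKsub isCompact_Icc.measure_lt_top.ne
    have h1 : 2 * r * (1 - δ) ≤ volume.real K := (ENNReal.ofReal_le_iff_le_toReal hfin).1 hKmeas
    have h2 : volume.real K' = r⁻¹ * volume.real K := by
      rw [measureReal_def, hK', Real.volume_preimage_mul_left hr.ne', ENNReal.toReal_mul,
        ENNReal.toReal_ofReal (abs_nonneg _), abs_of_pos (inv_pos.2 hr), measureReal_def]
    rw [h2, inv_mul_eq_div, le_div_iff₀ hr]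
    linarith
  have key := le_harmonicMeasure_of_unit_disk hδ0 hδ1 hK'c hK'1 hvol (by simpa [hK'] using h0K)
    (ω := fun z => ω (r * z)) ?_ (fun z hz => (hbd _ (hUmem z hz)).1) ?_
  · simpa using key
  · exact fun z hz => harmonicAt_comp_analyticAt (hharm.harmonicAt hUo (hUmem z hz)) (by fun_prop)
  · intro ζ hζ
    refine (hone (r * ζ) ⟨(hmem ζ).1 hζ.1, (hball ζ).1 hζ.2⟩).comp ?_
    exact ContinuousWithinAt.tendsto_nhdsWithin
      (Continuous.continuousWithinAt (by fun_prop)) hUmem
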